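/- Let k be a field, q ∈ k with q ≠ 0, and let Q be the quantum plane, the quotient of the free associative k-algebra on x₁, x₂ by the ideal generated by x₂x₁ − q·x₁x₂, and let α be the k-algebra automorphism of Q with α(x₁) = q^{-1}x₁, α(x₂) = q·x₂. For any c₃, c₄ ∈ k there exists a unique k-linear map δ : Q → Q with δ(1) = 0, δ(x₁) = c₃·x₂², δ(x₂) = c₄·x₁², and δ(uv) = α(u)·δ(v) + δ(u)·v for all u,v ∈ Q (i.e. δ is an α-derivation). Moreover, if q³ ≠ 1, then on the basis {x₁^i x₂^j} of Q one has δ(x₁^i x₂^j) = q^{−i}(1 − q³)^{−1}·[c₃·q·(1 − q^{3i})·x₁^{i−1}x₂^{j+2} + c₄·(1 − q^{3j})·x₁^{i+2}x₂^{j−1}] (each bracketed term being zero when its coefficient 1 − q^{3i}, respectively 1 − q^{3j}, vanishes). -/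

import Mathlib

open FreeAlgebra

/-- The defining relation of the quantum plane: `x₂x₁ = q·x₁x₂`. -/
inductive QuantumPlaneRel {k : Type*} [Field k] (q : k) :
    FreeAlgebra k (Fin 2) → FreeAlgebra k (Fin 2) → Prop
  | rel : QuantumPlaneRel q (ι k 1 * ι k 0) (q • (ι k 0 * ι k 1))

/-- The quantum plane `Q = k⟨x₁,x₂⟩/(x₂x₁ - q x₁x₂)`. -/
abbrev QuantumPlane (k : Type*) [Field k] (q : k) : Type _ := RingQuot (QuantumPlaneRel q)

theorem qp_induction {k : Type*} [Field k] (q : k) (P : QuantumPlane k q → Prop)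
    (hs : ∀ r : k, P (algebraMap k _ r))
    (h0 : P (RingQuot.mkAlgHom k (QuantumPlaneRel q) (ι k 0)))
    (h1 : P (RingQuot.mkAlgHom k (QuantumPlaneRel q) (ι k 1)))
    (hm : ∀ u v, P u → P v → P (u * v)) (ha : ∀ u v, P u → P v → P (u + v)) (u) : P u := by
  obtain ⟨w, rfl⟩ := RingQuot.mkAlgHom_surjective k (QuantumPlaneRel q) u
  induction w using FreeAlgebra.induction with
  | grade0 r => rw [AlgHom.commutes]; exact hs r
  | grade1 x => fin_cases x <;> assumption
  | mul a b iha ihb => rw [map_mul]; exact hm _ _ iha ihb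
  | add a b iha ihb => rw [map_add]; exact ha _ _ iha ihb

theorem qp_rel {k : Type*} [Field k] (q : k) :
    RingQuot.mkAlgHom k (QuantumPlaneRel q) (ι k 1) * RingQuot.mkAlgHom k (QuantumPlaneRel q) (ι k 0)
     = q • (RingQuot.mkAlgHom k (QuantumPlaneRel q) (ι k 0) *
        RingQuot.mkAlgHom k (QuantumPlaneRel q) (ι k 1)) := by
  rw [← map_mul, ← map_mul, ← map_smul]
  exact RingQuot.mkAlgHom_rel k QuantumPlaneRel.rel

theorem qp_exists {k : Type*} [Field k] (q : k) (hq : q ≠ 0)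
    (α : QuantumPlane k q ≃ₐ[k] QuantumPlane k q) (X Y : QuantumPlane k q)
    (hX : X = RingQuot.mkAlgHom k (QuantumPlaneRel q) (ι k 0))
    (hY : Y = RingQuot.mkAlgHom k (QuantumPlaneRel q) (ι k 1))
    (hα1 : α X = q⁻¹ • X) (hα2 : α Y = q • Y) (c₃ c₄ : k) :
    ∃ δ : QuantumPlane k q →ₗ[k] QuantumPlane k q,
      δ 1 = 0 ∧ δ X = c₃ • Y ^ 2 ∧ δ Y = c₄ • X ^ 2 ∧
      ∀ u v : QuantumPlane k q, δ (u * v) = α u * δ v + δ u * v := by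
  have hr : Y * X = q • (X * Y) := by rw [hX, hY]; exact qp_rel q
  let f : FreeAlgebra k (Fin 2) →ₐ[k] Matrix (Fin 2) (Fin 2) (QuantumPlane k q) :=
    FreeAlgebra.lift k ![!![α X, c₃ • Y ^ 2; 0, X], !![α Y, c₄ • X ^ 2; 0, Y]]
  have hf : ∀ ⦃a b⦄, QuantumPlaneRel q a b → f a = f b := by
    rintro _ _ ⟨⟩
    simp only [f, map_mul, map_smul, FreeAlgebra.lift_ι_apply]
    ext i j
    fin_cases i <;> fin_cases j
    · simp [Matrix.mul_apply, Fin.sum_univ_two, hα1, hα2, hr, smul_smul, hq]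
    · simp [Matrix.mul_apply, Fin.sum_univ_two, hα1, hα2, smul_smul, hq, pow_two, mul_assoc]
      rw [mul_comm c₃ q, add_comm]
    · simp [Matrix.mul_apply, Fin.sum_univ_two]
    · simp [Matrix.mul_apply, Fin.sum_univ_two, hr]
  let g := RingQuot.liftAlgHom k ⟨f, hf⟩
  have hgX : g X = !![α X, c₃ • Y ^ 2; 0, X] := by
    conv_lhs => rw [hX]
    simp only [g, RingQuot.liftAlgHom_mkAlgHom_apply, f, FreeAlgebra.lift_ι_apply]
    rfl
  have hgY : g Y = !![α Y, c₄ • X ^ 2; 0, Y] := by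
    conv_lhs => rw [hY]
    simp only [g, RingQuot.liftAlgHom_mkAlgHom_apply, f, FreeAlgebra.lift_ι_apply]
    rfl
  have key : ∀ u, g u 0 0 = α u ∧ g u 1 0 = 0 ∧ g u 1 1 = u := by
    apply qp_induction q
    · intro r
      simp [Matrix.algebraMap_matrix_apply]
    · rw [← hX, hgX]; simp
    · rw [← hY, hgY]; simp
    · rintro u v ⟨a, b, c⟩ ⟨a', b', c'⟩
      simp [Matrix.mul_apply, Fin.sum_univ_two, *]
    · rintro u v ⟨a, b, c⟩ ⟨a', b', c'⟩
      simp [*]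
  refine ⟨{ toFun := fun u => g u 0 1, map_add' := fun u v => by simp,
            map_smul' := fun r u => by simp }, ?_, ?_, ?_, ?_⟩
  · simp
  · simp [hgX]
  · simp [hgY]
  · intro u v
    simp [Matrix.mul_apply, Fin.sum_univ_two, key]

theorem qp_comm1 {k A : Type*} [Field k] [Ring A] [Algebra k A] (q : k) (X Y : A)
    (hr : Y * X = q • (X * Y)) (n : ℕ) : Y * X ^ n = q ^ n • (X ^ n * Y) := by
  induction n with
  | zero => simp
  | succ n ih =>
    rw [pow_succ, ← mul_assoc, ih, smul_mul_assoc, mul_assoc, hr, mul_smul_comm, smul_smul,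
      mul_assoc, ← pow_succ]

theorem qp_formula {k A : Type*} [Field k] [Ring A] [Algebra k A] (q : k) (hq : q ≠ 0) (X Y : A)
    (hr : Y * X = q • (X * Y)) (α : A ≃ₐ[k] A)
    (hα1 : α X = q⁻¹ • X) (hα2 : α Y = q • Y) (c₃ c₄ : k) (h3 : q ^ 3 ≠ 1) (δ : A →ₗ[k] A)
    (d1 : δ 1 = 0) (dX : δ X = c₃ • Y ^ 2) (dY : δ Y = c₄ • X ^ 2)
    (dm : ∀ u v, δ (u * v) = α u * δ v + δ u * v) (i j : ℕ) :
    δ (X ^ i * Y ^ j) =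
      (q⁻¹ ^ i * (1 - q ^ 3)⁻¹ * (c₃ * q * (1 - q ^ (3 * i)))) • (X ^ (i - 1) * Y ^ (j + 2)) +
      (q⁻¹ ^ i * (1 - q ^ 3)⁻¹ * (c₄ * (1 - q ^ (3 * j)))) • (X ^ (i + 2) * Y ^ (j - 1)) := by
  have h3' : 1 - q ^ 3 ≠ 0 := sub_ne_zero.2 (Ne.symm h3)
  have A1 : ∀ i : ℕ, δ (X ^ i) =
      (q⁻¹ ^ i * (1 - q ^ 3)⁻¹ * (c₃ * q * (1 - q ^ (3 * i)))) • (X ^ (i - 1) * Y ^ 2) := by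
    intro i
    induction i with
    | zero => simp [d1]
    | succ n ih =>
      have hc : Y ^ 2 * X ^ n = (q ^ n * q ^ n) • (X ^ n * Y ^ 2) := by
        rw [pow_two, mul_assoc, qp_comm1 q X Y hr, mul_smul_comm, ← mul_assoc,
          qp_comm1 q X Y hr, smul_mul_assoc, smul_smul, mul_assoc]
      have hx : (q⁻¹ ^ n * (1 - q ^ 3)⁻¹ * (c₃ * q * (1 - q ^ (3 * n)))) • (X * (X ^ (n - 1) * Y ^ 2))
        = (q⁻¹ ^ n * (1 - q ^ 3)⁻¹ * (c₃ * q * (1 - q ^ (3 * n)))) • (X ^ n * Y ^ 2) := by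
        cases n with
        | zero => simp
        | succ m => rw [← mul_assoc X, Nat.add_sub_cancel, ← pow_succ']
      rw [pow_succ', dm, ih, dX, hα1, smul_mul_assoc, mul_smul_comm, hx, smul_mul_assoc, hc,
        smul_smul, smul_smul, ← add_smul, Nat.add_sub_cancel]
      congr 1
      simp only [inv_pow]
      field_simp
      ring
  have A2 : ∀ j : ℕ, δ (Y ^ j) =
      ((1 - q ^ 3)⁻¹ * (c₄ * (1 - q ^ (3 * j)))) • (X ^ 2 * Y ^ (j - 1)) := by
    intro j
    induction j with
    | zero => simp [d1]
    | succ n ih =>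
      have hx : ((1 - q ^ 3)⁻¹ * (c₄ * (1 - q ^ (3 * n)))) • (Y * (X ^ 2 * Y ^ (n - 1)))
        = ((1 - q ^ 3)⁻¹ * (c₄ * (1 - q ^ (3 * n))) * q ^ 2) • (X ^ 2 * Y ^ n) := by
        cases n with
        | zero => simp
        | succ m => rw [← mul_assoc Y, qp_comm1 q X Y hr, Nat.add_sub_cancel, smul_mul_assoc,
                      mul_assoc, ← pow_succ', smul_smul]
      rw [pow_succ', dm, ih, dY, hα2, smul_mul_assoc, mul_smul_comm, hx, smul_mul_assoc,
        smul_smul, ← add_smul, Nat.add_sub_cancel]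
      congr 1
      field_simp
      ring
  rw [dm, A1, A2, map_pow, hα1, smul_pow, smul_mul_assoc, mul_smul_comm, smul_smul,
    smul_mul_assoc, add_comm, mul_assoc (X ^ (i-1)), ← pow_add, add_comm 2 j, ← mul_assoc (X ^ i),
    ← pow_add, mul_assoc (q⁻¹ ^ i) _ (c₄ * _)]

theorem quantum_plane_alpha_derivation {k : Type*} [Field k] (q : k) (hq : q ≠ 0)
    (α : QuantumPlane k q ≃ₐ[k] QuantumPlane k q)
    (hα1 : α (RingQuot.mkAlgHom k (QuantumPlaneRel q) (ι k 0)) =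
      q⁻¹ • RingQuot.mkAlgHom k (QuantumPlaneRel q) (ι k 0))
    (hα2 : α (RingQuot.mkAlgHom k (QuantumPlaneRel q) (ι k 1)) =
      q • RingQuot.mkAlgHom k (QuantumPlaneRel q) (ι k 1))
    (c₃ c₄ : k) :
    (∃! δ : QuantumPlane k q →ₗ[k] QuantumPlane k q,
      δ 1 = 0 ∧
      δ (RingQuot.mkAlgHom k (QuantumPlaneRel q) (ι k 0)) =
        c₃ • (RingQuot.mkAlgHom k (QuantumPlaneRel q) (ι k 1)) ^ 2 ∧
      δ (RingQuot.mkAlgHom k (QuantumPlaneRel q) (ι k 1)) =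
        c₄ • (RingQuot.mkAlgHom k (QuantumPlaneRel q) (ι k 0)) ^ 2 ∧
      ∀ u v : QuantumPlane k q, δ (u * v) = α u * δ v + δ u * v) ∧
    (q ^ 3 ≠ 1 →
      ∀ δ : QuantumPlane k q →ₗ[k] QuantumPlane k q,
        (δ 1 = 0 ∧
          δ (RingQuot.mkAlgHom k (QuantumPlaneRel q) (ι k 0)) =
            c₃ • (RingQuot.mkAlgHom k (QuantumPlaneRel q) (ι k 1)) ^ 2 ∧
          δ (RingQuot.mkAlgHom k (QuantumPlaneRel q) (ι k 1)) =
            c₄ • (RingQuot.mkAlgHom k (QuantumPlaneRel q) (ι k 0)) ^ 2 ∧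
          ∀ u v : QuantumPlane k q, δ (u * v) = α u * δ v + δ u * v) →
        ∀ i j : ℕ,
          δ ((RingQuot.mkAlgHom k (QuantumPlaneRel q) (ι k 0)) ^ i *
              (RingQuot.mkAlgHom k (QuantumPlaneRel q) (ι k 1)) ^ j) =
            (q⁻¹ ^ i * (1 - q ^ 3)⁻¹ * (c₃ * q * (1 - q ^ (3 * i)))) •
                ((RingQuot.mkAlgHom k (QuantumPlaneRel q) (ι k 0)) ^ (i - 1) *
                  (RingQuot.mkAlgHom k (QuantumPlaneRel q) (ι k 1)) ^ (j + 2)) +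
              (q⁻¹ ^ i * (1 - q ^ 3)⁻¹ * (c₄ * (1 - q ^ (3 * j)))) •
                ((RingQuot.mkAlgHom k (QuantumPlaneRel q) (ι k 0)) ^ (i + 2) *
                  (RingQuot.mkAlgHom k (QuantumPlaneRel q) (ι k 1)) ^ (j - 1))) := by
  refine ⟨?_, ?_⟩
  · obtain ⟨δ, h1, hx, hy, hm⟩ := qp_exists q hq α _ _ rfl rfl hα1 hα2 c₃ c₄
    refine ⟨δ, ⟨h1, hx, hy, hm⟩, ?_⟩
    rintro δ' ⟨h1', hx', hy', hm'⟩
    ext u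
    revert u
    apply qp_induction q
    · intro r
      rw [Algebra.algebraMap_eq_smul_one, map_smul, map_smul, h1, h1']
    · rw [hx, hx']
    · rw [hy, hy']
    · intro u v hu hv
      rw [hm, hm', hu, hv]
    · intro u v hu hv
      rw [map_add, map_add, hu, hv]
  · rintro h3 δ ⟨h1, hx, hy, hm⟩ i j
    exact qp_formula q hq _ _ (qp_rel q) α hα1 hα2 c₃ c₄ h3 δ h1 hx hy hm i j
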